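/- Let (U,S) be an instance of Exact 3-Set Cover with |U|=3k, |S|=m and 1 ≤ k ≤ m, and let M be the multilayer network constructed from it as described, with evader v̂, contacts F = U ∪ W, closeness centrality, and safety margins d^{α_i} = 1 for every layer α_i. Then S contains k pairwise disjoint sets whose union is U if and only if this instance of Multilayer Local Hiding has a solution, i.e., there is an admissible edge set A* joining v̂ to every contact in at least one layer such that in every layer α_i of the resulting network at least one node has closeness centrality in the graph of layer α_i strictly greater than that of v̂. -/

import Mathlib

open scoped Classical ENNReal

/-- A multilayer network: `occ v α` means node `v` occurs in layer `α`;
`Edge` is the edge relation on occurrences. -/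
structure MLNet (V : Type*) (L : Type*) where
  occ : V → L → Prop
  Edge : V × L → V × L → Prop

namespace MLNet

variable {V : Type*} {L : Type*}

/-- The axioms of a multilayer network with diagonal couplings: the edge relation is
symmetric, has no self-loops, joins only occurrences, and inter-layer edges join
two occurrences of the same node. -/
def IsValid (M : MLNet V L) : Prop :=
  (∀ a b, M.Edge a b → M.Edge b a) ∧
  (∀ a, ¬ M.Edge a a) ∧
  (∀ a b, M.Edge a b → M.occ a.1 a.2 ∧ M.occ b.1 b.2) ∧
  (∀ a b, M.Edge a b → a.2 ≠ b.2 → a.1 = b.1)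

/-- The simple graph on occurrences given by the (symmetrized) edge relation. -/
def flat (M : MLNet V L) : SimpleGraph (V × L) := SimpleGraph.fromRel M.Edge

/-- Global degree centrality: the number of nodes `w ≠ v` such that some edge joins an
occurrence of `v` and an occurrence of `w`. -/
noncomputable def degGlobal (M : MLNet V L) (v : V) : ℕ :=
  {w : V | w ≠ v ∧ ∃ α β, M.Edge (v, α) (w, β) ∨ M.Edge (w, β) (v, α)}.ncard

/-- Multilayer distance: the least length of a path from an occurrence of `v` to an
occurrence of `w` (`⊤` if there is none). -/
noncomputable def mdist (M : MLNet V L) (v w : V) : ℕ∞ :=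
  ⨅ (α : L) (β : L) (_ : M.occ v α) (_ : M.occ w β), M.flat.edist (v, α) (w, β)

/-- Global closeness centrality, valued in `ℝ≥0∞` (so that `1/∞ = 0`). -/
noncomputable def closGlobal (M : MLNet V L) [Fintype V] (v : V) : ℝ≥0∞ :=
  ∑ w ∈ Finset.univ.filter (fun w => w ≠ v), ((M.mdist v w : ℝ≥0∞))⁻¹

variable [Fintype V] [Fintype L]

/-- The number of shortest multilayer paths between nodes `w` and `u`
(`0` if they are not connected). -/
noncomputable def numSP (M : MLNet V L) (w u : V) : ℕ :=
  ∑ α : L, ∑ β : L,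
    if M.occ w α ∧ M.occ u β then
      (M.flat.finsetWalkLength (M.mdist w u).toNat (w, α) (u, β)).card
    else 0

/-- The number of pairs `(v^γ, p)` where `p` is a shortest multilayer path between `w` and `u`
passing through the occurrence `v^γ`. -/
noncomputable def numSPthrough (M : MLNet V L) (v w u : V) : ℕ :=
  ∑ α : L, ∑ β : L,
    if M.occ w α ∧ M.occ u β then
      ∑ p ∈ M.flat.finsetWalkLength (M.mdist w u).toNat (w, α) (u, β),
        (Finset.univ.filter (fun γ : L => (v, γ) ∈ p.support)).card
    else 0

/-- Global betweenness centrality: the sum over unordered pairs `{w,u}` of connected nodes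
(distinct from `v`) of the fraction of shortest multilayer paths passing through an
occurrence of `v` (division by zero, for unconnected pairs, gives `0`). -/
noncomputable def betwGlobal (M : MLNet V L) (v : V) : ℝ :=
  (1 / 2) * ∑ w : V, ∑ u : V,
    if w ≠ v ∧ u ≠ v ∧ w ≠ u then (M.numSPthrough v w u : ℝ) / (M.numSP w u : ℝ) else 0

/-- The simple graph `G^α` of a single layer (nodes not occurring in `α` are isolated). -/
def layerGraph (M : MLNet V L) (α : L) : SimpleGraph V :=
  SimpleGraph.fromRel (fun v w => M.Edge (v, α) (w, α))

/-- Degree of a node in the graph of layer `α`. -/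
noncomputable def layerDeg (M : MLNet V L) (α : L) (v : V) : ℕ :=
  ((M.layerGraph α).neighborSet v).ncard

end MLNet

/-- `Admissible M ve F A`: `A` encodes a set of intra-layer edges joining the evader `ve`
to contacts; `(v, α) ∈ A` encodes the edge `(ve^α, v^α)`, which requires `v ∈ F` and
both `ve` and `v` to occur in layer `α`. -/
def Admissible {V L : Type*} (M : MLNet V L) (ve : V) (F : Set V) (A : Set (V × L)) : Prop :=
  ∀ p ∈ A, p.1 ∈ F ∧ M.occ ve p.2 ∧ M.occ p.1 p.2

/-- The network obtained from `M` by adding, for each `(v, α) ∈ A`, the edge `(ve^α, v^α)`. -/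
def MLNet.addEdges {V L : Type*} (M : MLNet V L) (ve : V) (A : Set (V × L)) : MLNet V L where
  occ := M.occ
  Edge a b := M.Edge a b ∨
    ∃ p ∈ A, (a = (ve, p.2) ∧ b = (p.1, p.2)) ∨ (b = (ve, p.2) ∧ a = (p.1, p.2))

/-- `A` joins the evader to every contact in at least one layer. -/
def ConnectsAll {V L : Type*} (F : Set V) (A : Set (V × L)) : Prop :=
  ∀ v ∈ F, ∃ α, (v, α) ∈ A

section SG

variable {V : Type*} [Fintype V]

/-- Closeness centrality in a simple graph, valued in `ℝ≥0∞` (so that `1/∞ = 0`). -/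
noncomputable def closSG (G : SimpleGraph V) (v : V) : ℝ≥0∞ :=
  ∑ w ∈ Finset.univ.filter (fun w => w ≠ v), ((G.edist v w : ℝ≥0∞))⁻¹

/-- The number of shortest paths between `w` and `u` in a simple graph
(`0` if they are not connected and distinct). -/
noncomputable def numSPsg (G : SimpleGraph V) (w u : V) : ℕ :=
  (G.finsetWalkLength (G.edist w u).toNat w u).card

/-- The number of shortest paths between `w` and `u` passing through `v`. -/
noncomputable def numSPsgThrough (G : SimpleGraph V) (v w u : V) : ℕ :=
  ((G.finsetWalkLength (G.edist w u).toNat w u).filter (fun p => v ∈ p.support)).card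

/-- Betweenness centrality in a simple graph: the sum over unordered pairs `{w,u}` of
connected vertices distinct from `v` of the fraction of shortest paths through `v`. -/
noncomputable def betwSG (G : SimpleGraph V) (v : V) : ℝ :=
  (1 / 2) * ∑ w : V, ∑ u : V,
    if w ≠ v ∧ u ≠ v ∧ w ≠ u then (numSPsgThrough G v w u : ℝ) / (numSPsg G w u : ℝ) else 0

end SG

namespace Stmt5

/-- Nodes: the universe `U`, contacts `W = {w₁,…,w_{2(m-k)}}`, nodes `A = {a₁,…,a_{2(m-k)}}`,
nodes `C = {c₁,…,c₅}`, and the evader. -/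
inductive Node (k m : ℕ) where
  | u : Fin (3 * k) → Node k m
  | w : Fin (2 * (m - k)) → Node k m
  | a : Fin (2 * (m - k)) → Node k m
  | c : Fin 5 → Node k m
  | ve : Node k m
deriving DecidableEq, Fintype

variable {k m : ℕ}

/-- Occurrences: `u j` occurs in layer `αᵢ` iff `j ∈ S i`; all other nodes occur in
every layer. -/
def occ (S : Fin m → Finset (Fin (3 * k))) : Node k m → Fin m → Prop
  | .u j, i => j ∈ S i
  | _, _ => True

/-- Edges in every layer: `{wᵢ, aᵢ}` for each `i`, and `{c₁,c₂}, {c₁,c₃}, {c₁,c₄}, {c₄,c₅}`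
(here `c₁,…,c₅` are indexed by `0,…,4`); there are no other edges. -/
def edge : Node k m × Fin m → Node k m × Fin m → Prop
  | (.w i, t), (.a j, t') => t = t' ∧ (i : ℕ) = (j : ℕ)
  | (.c i, t), (.c j, t') => t = t' ∧
      (((i : ℕ) = 0 ∧ ((j : ℕ) = 1 ∨ (j : ℕ) = 2 ∨ (j : ℕ) = 3)) ∨ ((i : ℕ) = 3 ∧ (j : ℕ) = 4))
  | _, _ => False

/-- The gadget multilayer network constructed from the Exact 3-Set Cover instance `S`. -/
def M (S : Fin m → Finset (Fin (3 * k))) : MLNet (Node k m) (Fin m) where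
  occ := occ S
  Edge := edge

/-- The contacts: all of `U ∪ W`. -/
def F : Set (Node k m) :=
  {x | (∃ j, x = Node.u j) ∨ (∃ j, x = Node.w j)}

end Stmt5

section Reduction

open Finset

/-- The degree of `v` plus the number of other vertices reachable from `v`. -/
noncomputable def degAddReach {V : Type*} [Fintype V] (G : SimpleGraph V) (v : V) : ℕ :=
  #{w | G.Adj v w} + #{w | w ≠ v ∧ G.Reachable v w}

lemma mem_of_reachable {V : Type*} (G : SimpleGraph V) {s : Set V} (hs : ∀ x ∈ s, ∀ y, G.Adj x y → y ∈ s) {x y : V}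
    (hx : x ∈ s) (h : G.Reachable x y) : y ∈ s := by
  obtain ⟨p⟩ := h
  induction p with
  | nil => exact hx
  | cons ha _ ih => exact ih (hs _ hx _ ha)

lemma two_mul_lt_two_mul_iff {a b : ℝ≥0∞} : 2 * a < 2 * b ↔ a < b :=
  ENNReal.mul_lt_mul_iff_right (by simp) (by simp)

section Closeness

variable {V : Type*} [Fintype V] (G : SimpleGraph V)

lemma two_mul_edist_inv_le {v w : V} (hvw : w ≠ v) :
    2 * ((G.edist v w : ℝ≥0∞))⁻¹ ≤
      (((if G.Adj v w then 1 else 0) + (if G.Reachable v w then 1 else 0) : ℕ) : ℝ≥0∞) := by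
  by_cases hr : G.Reachable v w
  · by_cases ha : G.Adj v w
    · simp [hr, ha, SimpleGraph.edist_eq_one_iff_adj.2 ha, one_add_one_eq_two]
    · have h2 : (2 : ℕ∞) ≤ G.edist v w := by
        by_contra! h
        have h1 : G.edist v w ≤ 1 := Order.le_of_lt_add_one (by simpa [one_add_one_eq_two] using h)
        rcases SimpleGraph.edist_le_one_iff_adj_or_eq.1 h1 with h | h
        · exact ha h
        · exact hvw h.symm
      have h3 : (2 : ℝ≥0∞) ≤ (G.edist v w : ℝ≥0∞) := by
        exact_mod_cast (ENat.toENNReal_le (m := 2)).2 h2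
      simp only [ha, hr, if_true, if_false]
      calc 2 * ((G.edist v w : ℝ≥0∞))⁻¹ ≤ 2 * (2 : ℝ≥0∞)⁻¹ := by gcongr
        _ = _ := by simp [ENNReal.mul_inv_cancel]
  · simp [SimpleGraph.edist_eq_top_of_not_reachable hr]

lemma le_two_mul_edist_inv {v w : V} (hr : G.Reachable v w → G.edist v w ≤ 2) :
    (((if G.Adj v w then 1 else 0) + (if G.Reachable v w then 1 else 0) : ℕ) : ℝ≥0∞) ≤
      2 * ((G.edist v w : ℝ≥0∞))⁻¹ := by
  by_cases ha : G.Adj v w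
  · simp [ha.reachable, ha, SimpleGraph.edist_eq_one_iff_adj.2 ha, one_add_one_eq_two]
  · by_cases h : G.Reachable v w
    · have h3 : (G.edist v w : ℝ≥0∞) ≤ 2 := by
        exact_mod_cast (ENat.toENNReal_le (n := 2)).2 (hr h)
      simp only [ha, h, if_true, if_false]
      calc _ = 2 * (2 : ℝ≥0∞)⁻¹ := by simp [ENNReal.mul_inv_cancel]
        _ ≤ _ := by gcongr
    · simp [ha, h]

lemma degAddReach_eq_sum (v : V) :
    degAddReach G v = ∑ w ∈ Finset.univ.filter (fun w => w ≠ v),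
      ((if G.Adj v w then 1 else 0) + (if G.Reachable v w then 1 else 0)) := by
  rw [degAddReach, sum_add_distrib, ← card_filter, ← card_filter, filter_filter, filter_filter]
  congr 2
  ext w
  simp only [mem_filter, mem_univ, true_and]
  exact ⟨fun h => ⟨h.ne', h⟩, fun h => h.2⟩

lemma two_mul_closSG_le (v : V) : 2 * closSG G v ≤ (degAddReach G v : ℝ≥0∞) := by
  rw [closSG, degAddReach_eq_sum, mul_sum, Nat.cast_sum]
  exact sum_le_sum fun w hw => two_mul_edist_inv_le G (mem_filter.1 hw).2

lemma le_two_mul_closSG {v : V} (h : ∀ w, G.Reachable v w → G.edist v w ≤ 2) :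
    (degAddReach G v : ℝ≥0∞) ≤ 2 * closSG G v := by
  rw [closSG, degAddReach_eq_sum, mul_sum, Nat.cast_sum]
  exact sum_le_sum fun w _ => le_two_mul_edist_inv G (h w)

lemma card_reachable_eq {v z : V} (h : G.Reachable v z) :
    #{w | w ≠ v ∧ G.Reachable v w} = #{w | w ≠ z ∧ G.Reachable z w} := by
  have key : ∀ x, #{w | w ≠ x ∧ G.Reachable x w} = #{w | G.Reachable x w} - 1 := by
    intro x
    rw [← card_erase_of_mem (a := x) (by simp)]
    congr 1
    ext w
    simp
  rw [key, key]
  congr 2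
  ext w
  simp only [mem_filter, mem_univ, true_and]
  exact ⟨fun hw => h.symm.trans hw, fun hw => h.trans hw⟩

lemma degAddReach_le_of_closed {s : Finset V} {z : V}
    (hz : z ∈ s) (hs : ∀ x ∈ s, ∀ y, G.Adj x y → y ∈ s) :
    degAddReach G z ≤ 2 * (#s - 1) := by
  have h : ∀ y, G.Reachable z y → y ∈ s := fun y hy =>
    mem_of_reachable (s := (s : Set V)) G (fun x hx y h => hs x hx y h) hz hy
  have h1 : #{x | G.Adj z x} ≤ #(s.erase z) := card_le_card fun x hx => by
    have hx := (mem_filter.1 hx).2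
    exact mem_erase.2 ⟨hx.ne', h x hx.reachable⟩
  have h2 : #{x | x ≠ z ∧ G.Reachable z x} ≤ #(s.erase z) := card_le_card fun x hx => by
    obtain ⟨hx, hr⟩ := (mem_filter.1 hx).2
    exact mem_erase.2 ⟨hx, h x hr⟩
  rw [card_erase_of_mem hz] at h1 h2
  rw [degAddReach]
  omega

end Closeness

namespace Stmt5

variable {k m : ℕ}

lemma sum_node {R : Type*} [AddCommMonoid R] (f : Node k m → R) :
    ∑ x, f x = ∑ j, f (.u j) + (∑ j, f (.w j) + (∑ j, f (.a j) + (∑ j, f (.c j) + f .ve))) := by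
  let e : Fin (3 * k) ⊕ Fin (2 * (m - k)) ⊕ Fin (2 * (m - k)) ⊕ Fin 5 ⊕ Unit ≃ Node k m :=
    { toFun := Sum.elim .u (Sum.elim .w (Sum.elim .a (Sum.elim .c fun _ => .ve)))
      invFun := fun
        | .u j => .inl j
        | .w j => .inr (.inl j)
        | .a j => .inr (.inr (.inl j))
        | .c j => .inr (.inr (.inr (.inl j)))
        | .ve => .inr (.inr (.inr (.inr ())))
      left_inv := by rintro (_ | _ | _ | _ | _) <;> rfl
      right_inv := by rintro (_ | _ | _ | _ | _) <;> rfl }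
  rw [← e.sum_comp]
  simp [Fintype.sum_sum_type, e]

/-- The graph of a single layer in which the evader is joined to `P ⊆ U` and `Q ⊆ W`. -/
def gadget (P : Finset (Fin (3 * k))) (Q : Finset (Fin (2 * (m - k)))) :
    SimpleGraph (Node k m) :=
  SimpleGraph.fromRel fun x y => match x, y with
    | .w i, .a j => i = j
    | .c i, .c j => (i = 0 ∧ (j = 1 ∨ j = 2 ∨ j = 3)) ∨ (i = 3 ∧ j = 4)
    | .ve, .u j => j ∈ P
    | .ve, .w j => j ∈ Q
    | _, _ => False

lemma layerGraph_addEdges {S : Fin m → Finset (Fin (3 * k))} {A : Set (Node k m × Fin m)}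
    (hA : Admissible (M S) Node.ve F A) (i : Fin m) :
    ((M S).addEdges Node.ve A).layerGraph i =
      gadget {j | (Node.u j, i) ∈ A} {j | (Node.w j, i) ∈ A} := by
  have hF : ∀ x, (x, i) ∈ A → x ∈ F := fun x hx => (hA _ hx).1
  have ha : ∀ j, (Node.a j, i) ∉ A := fun j hj => by simpa [F] using hF _ hj
  have hc : ∀ j, (Node.c j, i) ∉ A := fun j hj => by simpa [F] using hF _ hj
  ext x y
  rcases x with _ | _ | _ | x | _ <;> rcases y with _ | _ | _ | y | _ <;>
    simp [MLNet.layerGraph, gadget, MLNet.addEdges, M, edge, Fin.val_inj, ha, hc]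
  revert x y
  decide

section Gadget

variable (P : Finset (Fin (3 * k))) (Q : Finset (Fin (2 * (m - k))))

lemma adj_ve (x : Node k m) : (gadget P Q).Adj .ve x ↔
    (∃ j ∈ P, x = .u j) ∨ ∃ j ∈ Q, x = .w j := by
  rcases x with _ | _ | _ | _ | _ <;> simp [gadget]

lemma adj_u (j : Fin (3 * k)) (x : Node k m) : (gadget P Q).Adj (.u j) x ↔
    j ∈ P ∧ x = .ve := by
  rcases x with _ | _ | _ | _ | _ <;> simp [gadget]

lemma adj_w (j : Fin (2 * (m - k))) (x : Node k m) : (gadget P Q).Adj (.w j) x ↔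
    x = .a j ∨ (j ∈ Q ∧ x = .ve) := by
  rcases x with _ | _ | _ | _ | _ <;> simp [gadget, eq_comm]

lemma adj_a (j : Fin (2 * (m - k))) (x : Node k m) : (gadget P Q).Adj (.a j) x ↔
    x = .w j := by
  rcases x with _ | _ | _ | _ | _ <;> simp [gadget]

lemma adj_c (i : Fin 5) (x : Node k m) : (gadget P Q).Adj (.c i) x ↔
    ∃ j, x = .c j ∧ ((i = 0 ∧ (j = 1 ∨ j = 2 ∨ j = 3)) ∨ (i = 3 ∧ j = 4) ∨
      (j = 0 ∧ (i = 1 ∨ i = 2 ∨ i = 3)) ∨ (j = 3 ∧ i = 4)) := by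
  rcases x with _ | _ | _ | x | _ <;> simp [gadget]
  revert i x
  decide

/-- The vertices connected to the evader. -/
def evaderComponent : Set (Node k m)
  | .u j => j ∈ P
  | .w j => j ∈ Q
  | .a j => j ∈ Q
  | .c _ => False
  | .ve => True

lemma edist_ve_le_two {x : Node k m} (hx : x ∈ evaderComponent P Q) :
    (gadget P Q).edist .ve x ≤ 2 := by
  have key : ∀ y, (gadget P Q).Adj .ve y → (gadget P Q).edist .ve y = 1 :=
    fun y hy => SimpleGraph.edist_eq_one_iff_adj.2 hy
  rcases x with j | j | j | j | _
  · rw [key _ ((adj_ve ..).2 (.inl ⟨j, hx, rfl⟩))]; norm_num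
  · rw [key _ ((adj_ve ..).2 (.inr ⟨j, hx, rfl⟩))]; norm_num
  · refine (SimpleGraph.edist_triangle (v := Node.w j)).trans ?_
    rw [key _ ((adj_ve ..).2 (.inr ⟨j, hx, rfl⟩)),
      SimpleGraph.edist_eq_one_iff_adj.2 ((adj_w ..).2 (.inl rfl)), one_add_one_eq_two]
  · exact hx.elim
  · simp

lemma reachable_ve_iff (x : Node k m) :
    (gadget P Q).Reachable .ve x ↔ x ∈ evaderComponent P Q := by
  constructor
  · refine mem_of_reachable _ (fun y hy z hz => ?_) trivial
    rcases y with j | j | j | j | _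
    · obtain ⟨_, rfl⟩ := (adj_u ..).1 hz
      trivial
    · obtain rfl | ⟨_, rfl⟩ := (adj_w ..).1 hz
      · exact hy
      · trivial
    · obtain rfl := (adj_a ..).1 hz
      exact hy
    · exact hy.elim
    · obtain ⟨i, hi, rfl⟩ | ⟨i, hi, rfl⟩ := (adj_ve ..).1 hz <;> exact hi
  · intro hx
    by_contra h
    have := edist_ve_le_two P Q hx
    rw [SimpleGraph.edist_eq_top_of_not_reachable h] at this
    simp at this

lemma degAddReach_ve : degAddReach (gadget P Q) .ve = 2 * #P + 3 * #Q := by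
  rw [degAddReach, card_filter, card_filter, sum_node, sum_node]
  simp only [reachable_ve_iff, adj_ve]
  have h1 : ∀ j, Node.u (m := m) j ∈ evaderComponent P Q ↔ j ∈ P := fun _ => Iff.rfl
  have h2 : ∀ j, Node.w j ∈ evaderComponent P Q ↔ j ∈ Q := fun _ => Iff.rfl
  have h3 : ∀ j, Node.a j ∈ evaderComponent P Q ↔ j ∈ Q := fun _ => Iff.rfl
  have h4 : ∀ j, Node.c j ∉ evaderComponent P Q := fun _ h => h
  simp [h1, h2, h3, h4]
  ring

lemma two_mul_closSG_ve :
    2 * closSG (gadget P Q) .ve = ((2 * #P + 3 * #Q : ℕ) : ℝ≥0∞) := by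
  rw [← degAddReach_ve]
  exact le_antisymm (two_mul_closSG_le _ _) (le_two_mul_closSG _ fun w hw =>
    edist_ve_le_two P Q ((reachable_ve_iff ..).1 hw))

lemma reachable_c {i : Fin 5} {x : Node k m} (h : (gadget P Q).Reachable (.c i) x) :
    ∃ j, x = .c j := by
  refine mem_of_reachable (s := {x | ∃ j, x = Node.c j}) _ ?_ ⟨i, rfl⟩ h
  rintro _ ⟨j, rfl⟩ z hz
  obtain ⟨l, rfl, -⟩ := (adj_c ..).1 hz
  exact ⟨l, rfl⟩

lemma degAddReach_c_le (i : Fin 5) : degAddReach (gadget P Q) (.c i) ≤ 7 := by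
  have h1 : #{x | (gadget P Q).Adj (.c i) x} ≤ 3 := by
    rw [card_filter, sum_node]
    simp only [adj_c]
    simp
    revert i
    decide
  refine Nat.add_le_add (d := 4) h1 ?_
  calc _ ≤ #(((univ : Finset (Fin 5)).erase i).image (Node.c : Fin 5 → Node k m)) := by
        refine card_le_card fun x hx => ?_
        simp only [mem_filter, mem_univ, true_and] at hx
        obtain ⟨hx, hr⟩ := hx
        obtain ⟨j, rfl⟩ := reachable_c P Q hr
        simpa using hx
    _ ≤ #(univ.erase i) := card_image_le
    _ = 4 := by simp

lemma le_two_mul_closSG_c_zero : (7 : ℝ≥0∞) ≤ 2 * closSG (gadget P Q) (.c 0) := by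
  have ha : ∀ j : Fin 5, j = 1 ∨ j = 2 ∨ j = 3 → (gadget P Q).Adj (.c 0) (.c j) :=
    fun j hj => (adj_c ..).2 ⟨j, rfl, .inl ⟨rfl, hj⟩⟩
  have h34 : (gadget P Q).Adj (.c 3) (.c 4) := (adj_c ..).2 ⟨4, rfl, .inr (.inl ⟨rfl, rfl⟩)⟩
  have hd : ∀ j, (gadget P Q).edist (.c 0) (.c j) ≤ 2 := by
    intro j
    by_cases hj : j = 1 ∨ j = 2 ∨ j = 3
    · rw [SimpleGraph.edist_eq_one_iff_adj.2 (ha j hj)]; norm_num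
    · obtain rfl | rfl : j = 0 ∨ j = 4 := by omega
      · simp
      · refine (SimpleGraph.edist_triangle (v := Node.c 3)).trans ?_
        rw [SimpleGraph.edist_eq_one_iff_adj.2 (ha 3 (by simp)),
          SimpleGraph.edist_eq_one_iff_adj.2 h34, one_add_one_eq_two]
  have hr : ∀ j, (gadget P Q).Reachable (.c 0) (.c j) := by
    intro j
    by_contra h
    have := hd j
    rw [SimpleGraph.edist_eq_top_of_not_reachable h] at this
    simp at this
  have h7 : 7 ≤ degAddReach (gadget P Q) (.c 0) := by
    have h1 : 3 ≤ #{x | (gadget P Q).Adj (.c 0) x} := by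
      calc 3 = #(({1, 2, 3} : Finset (Fin 5)).image (Node.c : Fin 5 → Node k m)) := by
            rw [card_image_of_injective _ fun _ _ => Node.c.inj]; rfl
        _ ≤ _ := by
          refine card_le_card fun x hx => ?_
          obtain ⟨j, hj, rfl⟩ := mem_image.1 hx
          exact mem_filter.2 ⟨mem_univ _, ha j (by simpa using hj)⟩
    refine Nat.add_le_add (c := 4) h1 ?_
    calc 4 = #(((univ : Finset (Fin 5)).erase 0).image (Node.c : Fin 5 → Node k m)) := by
          rw [card_image_of_injective _ fun _ _ => Node.c.inj]; rfl
      _ ≤ _ := by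
        refine card_le_card fun x hx => ?_
        obtain ⟨j, hj, rfl⟩ := mem_image.1 hx
        simp only [mem_filter, mem_univ, true_and]
        exact ⟨by simpa using hj, hr j⟩
  calc (7 : ℝ≥0∞) ≤ (degAddReach (gadget P Q) (.c 0) : ℝ≥0∞) := by exact_mod_cast h7
    _ ≤ _ := by
      refine le_two_mul_closSG _ fun w hw => ?_
      obtain ⟨j, rfl⟩ := reachable_c P Q hw
      exact hd j

lemma card_adj_le_two {z : Node k m} (hz : z ∈ evaderComponent P Q) (hve : z ≠ .ve) :
    #{x | (gadget P Q).Adj z x} ≤ 2 := by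
  rcases z with j | j | j | j | _
  · refine (card_le_card (t := {.ve}) fun x hx => ?_).trans (by simp)
    simp_all [adj_u]
  · refine (card_le_card (t := {.a j, .ve}) fun x hx => ?_).trans card_le_two
    simp only [mem_filter, adj_w] at hx
    simp only [mem_insert, mem_singleton]
    tauto
  · refine (card_le_card (t := {.w j}) fun x hx => ?_).trans (by simp)
    simp_all [adj_a]
  · exact hz.elim
  · exact absurd rfl hve

lemma degAddReach_le_seven {z : Node k m} (hz : z ∉ evaderComponent P Q) :
    degAddReach (gadget P Q) z ≤ 7 := by
  have hpair : ∀ j ∉ Q, ∀ x ∈ ({.w j, .a j} : Finset (Node k m)), ∀ y,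
      (gadget P Q).Adj x y → y ∈ ({.w j, .a j} : Finset (Node k m)) := by
    intro j hj x hx y hy
    simp only [mem_insert, mem_singleton] at hx ⊢
    rcases hx with rfl | rfl
    · have := (adj_w ..).1 hy; tauto
    · have := (adj_a ..).1 hy; tauto
  rcases z with j | j | j | j | _
  · refine (degAddReach_le_of_closed _ (s := {.u j}) (by simp) ?_).trans (by simp)
    intro x hx y hy
    obtain rfl := mem_singleton.1 hx
    exact absurd ((adj_u ..).1 hy).1 hz
  · have := degAddReach_le_of_closed _ (z := .w j) (by simp) (hpair j hz)
    have := card_le_two (a := Node.w (k := k) j) (b := .a j)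
    omega
  · have := degAddReach_le_of_closed _ (z := .a j) (by simp) (hpair j hz)
    have := card_le_two (a := Node.w (k := k) j) (b := .a j)
    omega
  · exact degAddReach_c_le P Q j
  · exact absurd trivial hz

lemma closSG_ve_lt_c_zero (h : 2 * #P + 3 * #Q ≤ 6) :
    closSG (gadget P Q) .ve < closSG (gadget P Q) (.c 0) := by
  rw [← two_mul_lt_two_mul_iff, two_mul_closSG_ve]
  refine lt_of_lt_of_le ?_ (le_two_mul_closSG_c_zero P Q)
  exact_mod_cast Nat.lt_succ_of_le h

lemma le_six_of_closSG_ve_lt {z : Node k m}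
    (h : closSG (gadget P Q) .ve < closSG (gadget P Q) z) : 2 * #P + 3 * #Q ≤ 6 := by
  by_contra! h7
  rw [← two_mul_lt_two_mul_iff, two_mul_closSG_ve] at h
  have h' : 2 * #P + 3 * #Q < degAddReach (gadget P Q) z := by
    exact_mod_cast h.trans_le (two_mul_closSG_le _ z)
  by_cases hz : z ∈ evaderComponent P Q
  · by_cases hve : z = .ve
    · subst hve
      rw [degAddReach_ve] at h'
      exact h'.false
    · have h1 := card_adj_le_two P Q hz hve
      have h2 := card_reachable_eq _ ((reachable_ve_iff P Q z).2 hz)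
      have h3 := degAddReach_ve P Q
      have h4 : #{x | (gadget P Q).Adj .ve x} = #P + #Q := by
        rw [card_filter, sum_node]
        simp [adj_ve]
      rw [degAddReach] at h' h3
      omega
  · have := degAddReach_le_seven P Q hz
    omega

end Gadget

lemma exists_lt_closSG_iff {S : Fin m → Finset (Fin (3 * k))} {A : Set (Node k m × Fin m)}
    (hA : Admissible (M S) Node.ve F A) (i : Fin m) :
    (∃ z : Node k m, ((M S).addEdges Node.ve A).occ z i ∧
      closSG (((M S).addEdges Node.ve A).layerGraph i) Node.ve <
      closSG (((M S).addEdges Node.ve A).layerGraph i) z) ↔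
    2 * #{j | (Node.u j, i) ∈ A} + 3 * #{j | (Node.w j, i) ∈ A} ≤ 6 := by
  rw [layerGraph_addEdges hA]
  exact ⟨fun ⟨_, _, h⟩ => le_six_of_closSG_ve_lt _ _ h,
    fun h => ⟨.c 0, trivial, closSG_ve_lt_c_zero _ _ h⟩⟩

/-- If every `x` is related to some `i`, double counting bounds the number of all `x`. -/
lemma card_le_sum_card_fiber {X I : Type*} [Fintype X] [Fintype I] (r : X → I → Prop)
    (h : ∀ x, ∃ i, r x i) : Fintype.card X ≤ ∑ i, #{x | r x i} := by
  rw [← card_univ]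
  calc #univ ≤ #(univ.biUnion fun i => {x | r x i}) := card_le_card fun x _ => by simpa using h x
    _ ≤ _ := card_biUnion_le

lemma pairwise_disjoint_of_sum_card_le {X I : Type*} [Fintype X] (T : Finset I) (S : I → Finset X)
    (hcov : ∀ x, ∃ i ∈ T, x ∈ S i) (hcard : ∑ i ∈ T, #(S i) ≤ Fintype.card X) :
    ∀ i ∈ T, ∀ j ∈ T, i ≠ j → Disjoint (S i) (S j) := by
  intro i hi j hj hij
  rw [disjoint_iff_inter_eq_empty, ← card_eq_zero]
  have h1 : Fintype.card X ≤ #(S i ∪ S j) + ∑ l ∈ (T.erase i).erase j, #(S l) := by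
    rw [← card_univ]
    refine (card_le_card (t := (S i ∪ S j) ∪ ((T.erase i).erase j).biUnion S)
      fun x _ => ?_).trans ((card_union_le _ _).trans (by gcongr; exact card_biUnion_le))
    obtain ⟨l, hl, hx⟩ := hcov x
    simp only [mem_union, mem_biUnion, mem_erase]
    by_cases h1 : l = i
    · exact .inl (.inl (h1 ▸ hx))
    by_cases h2 : l = j
    · exact .inl (.inr (h2 ▸ hx))
    exact .inr ⟨l, ⟨h2, h1, hl⟩, hx⟩
  have h2 := card_union_add_card_inter (S i) (S j)
  have h3 := add_sum_erase T (fun l => #(S l)) hi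
  have h4 := add_sum_erase (T.erase i) (fun l => #(S l)) (mem_erase.2 ⟨hij.symm, hj⟩)
  omega

lemma exists_cover_of_hiding (hkm : k ≤ m) (S : Fin m → Finset (Fin (3 * k)))
    (hS : ∀ i, #(S i) = 3) {A : Set (Node k m × Fin m)}
    (hA : Admissible (M S) Node.ve F A) (hcon : ConnectsAll F A)
    (h : ∀ i, 2 * #{j | (Node.u j, i) ∈ A} + 3 * #{j | (Node.w j, i) ∈ A} ≤ 6) :
    ∃ T : Finset (Fin m), #T = k ∧ (∀ i ∈ T, ∀ j ∈ T, i ≠ j → Disjoint (S i) (S j)) ∧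
      ∀ x, ∃ i ∈ T, x ∈ S i := by
  have hu := card_le_sum_card_fiber (fun j i => (Node.u j, i) ∈ A) fun j => hcon _ (.inl ⟨j, rfl⟩)
  have hw := card_le_sum_card_fiber (fun j i => (Node.w j, i) ∈ A) fun j => hcon _ (.inr ⟨j, rfl⟩)
  rw [Fintype.card_fin] at hu hw
  have hsum : ∑ i : Fin m, (2 * #{j | (Node.u j, i) ∈ A} + 3 * #{j | (Node.w j, i) ∈ A}) =
      ∑ i : Fin m, 6 := by
    refine le_antisymm (sum_le_sum fun i _ => h i) ?_
    rw [sum_add_distrib, ← mul_sum, ← mul_sum]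
    simp only [sum_const, card_univ, Fintype.card_fin, smul_eq_mul]
    omega
  have heq := fun i => (sum_eq_sum_iff_of_le fun i _ => h i).1 hsum i (mem_univ i)
  let T : Finset (Fin m) := {i | #{j | (Node.w j, i) ∈ A} = 0}
  have hT : #T = k := by
    have h1 : ∑ i : Fin m, #{j | (Node.u j, i) ∈ A} = 3 * #T := by
      rw [card_filter, mul_sum]
      refine sum_congr rfl fun i _ => ?_
      have := heq i
      split_ifs <;> omega
    rw [sum_add_distrib, ← mul_sum, ← mul_sum] at hsum
    simp only [sum_const, card_univ, Fintype.card_fin, smul_eq_mul] at hsum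
    omega
  have hcov : ∀ x, ∃ i ∈ T, x ∈ S i := by
    intro x
    obtain ⟨i, hi⟩ := hcon (Node.u x) (.inl ⟨x, rfl⟩)
    have hpos : 0 < #{j | (Node.u j, i) ∈ A} := card_pos.2 ⟨x, by simpa using hi⟩
    have := heq i
    exact ⟨i, mem_filter.2 ⟨mem_univ _, by omega⟩, (hA _ hi).2.2⟩
  refine ⟨T, hT, pairwise_disjoint_of_sum_card_le T S hcov ?_, hcov⟩
  simp [hS, hT, mul_comm]

lemma exists_hiding_of_cover (S : Fin m → Finset (Fin (3 * k)))
    (hS : ∀ i, #(S i) = 3) {T : Finset (Fin m)} (hT : #T = k) (hcov : ∀ x, ∃ i ∈ T, x ∈ S i) :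
    ∃ A : Set (Node k m × Fin m), Admissible (M S) Node.ve F A ∧ ConnectsAll F A ∧
      ∀ i, 2 * #{j | (Node.u j, i) ∈ A} + 3 * #{j | (Node.w j, i) ∈ A} ≤ 6 := by
  have hTc : #Tᶜ = m - k := by rw [card_compl, hT, Fintype.card_fin]
  let e : Fin (m - k) ↪o Fin m := Tᶜ.orderEmbOfFin hTc
  have he : ∀ j, e j ∉ T := fun j => mem_compl.1 (Tᶜ.orderEmbOfFin_mem hTc j)
  let half : Fin (2 * (m - k)) → Fin (m - k) := fun j => ⟨j / 2, by omega⟩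
  refine ⟨{p | (∃ j, p.1 = .u j ∧ p.2 ∈ T ∧ j ∈ S p.2) ∨ ∃ j, p.1 = .w j ∧ e (half j) = p.2},
    ?_, ?_, fun i => ?_⟩
  · rintro ⟨x, i⟩ (⟨j, rfl, hi, hj⟩ | ⟨j, rfl, -⟩)
    · exact ⟨.inl ⟨j, rfl⟩, trivial, hj⟩
    · exact ⟨.inr ⟨j, rfl⟩, trivial, trivial⟩
  · rintro _ (⟨j, rfl⟩ | ⟨j, rfl⟩)
    · obtain ⟨i, hi, hj⟩ := hcov j
      exact ⟨i, .inl ⟨j, rfl, hi, hj⟩⟩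
    · exact ⟨_, .inr ⟨j, rfl, rfl⟩⟩
  · by_cases hi : i ∈ T
    · have h : ∀ j, e (half j) ≠ i := fun j hj => he _ (hj ▸ hi)
      simp [hi, h, hS]
    · have h2 : #{j | e (half j) = i} ≤ 2 := by
        by_cases hc : ∃ c, e c = i
        · obtain ⟨c, rfl⟩ := hc
          have h0 := c.2
          refine (card_le_card (t := {⟨2 * c, by omega⟩, ⟨2 * c + 1, by omega⟩})
            fun j hj => ?_).trans card_le_two
          have hj' := congrArg Fin.val (e.injective (mem_filter.1 hj).2)
          simp only [half] at hj'
          simp only [mem_insert, mem_singleton, Fin.ext_iff]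
          omega
        · rw [filter_eq_empty_iff.2 fun j _ hj => hc ⟨_, hj⟩]
          simp
      simp [hi]
      omega

end Stmt5

end Reduction

/-- **Theorem: Multilayer Local Hiding is NP-complete for closeness
centrality.** The Exact 3-Set Cover instance `(U, S)` has a solution iff the constructed
instance of Multilayer Local Hiding with closeness centrality and safety margins
`d^{αᵢ} = 1` has a solution. -/
theorem local_closeness_hiding_reduction (k m : ℕ) (hk : 1 ≤ k) (hkm : k ≤ m)
    (S : Fin m → Finset (Fin (3 * k))) (hS : ∀ i, (S i).card = 3) :
    (∃ T : Finset (Fin m), T.card = k ∧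
        (∀ i ∈ T, ∀ j ∈ T, i ≠ j → Disjoint (S i) (S j)) ∧
        (∀ x : Fin (3 * k), ∃ i ∈ T, x ∈ S i))
    ↔ (∃ A : Set (Stmt5.Node k m × Fin m),
        Admissible (Stmt5.M S) Stmt5.Node.ve Stmt5.F A ∧
        ConnectsAll Stmt5.F A ∧
        ∀ i : Fin m, ∃ z : Stmt5.Node k m,
          ((Stmt5.M S).addEdges Stmt5.Node.ve A).occ z i ∧
          closSG (((Stmt5.M S).addEdges Stmt5.Node.ve A).layerGraph i) Stmt5.Node.ve <
          closSG (((Stmt5.M S).addEdges Stmt5.Node.ve A).layerGraph i) z) := by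
  constructor
  · rintro ⟨T, hT, -, hcov⟩
    obtain ⟨A, hA, hcon, h⟩ := Stmt5.exists_hiding_of_cover S hS hT hcov
    exact ⟨A, hA, hcon, fun i => (Stmt5.exists_lt_closSG_iff hA i).2 (h i)⟩
  · rintro ⟨A, hA, hcon, h⟩
    exact Stmt5.exists_cover_of_hiding hkm S hS hA hcon fun i =>
      (Stmt5.exists_lt_closSG_iff hA i).1 (h i)
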